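/- Let g be a Lie superalgebra over a field F of characteristic zero admitting an osp-triple (e,f,h). Then every finite-dimensional g-module is completely reducible, i.e., it is a sum of irreducible g-submodules. -/

import Mathlib

/-- A Lie superalgebra over `F`: a `ℤ/2`-graded vector space with a bilinear bracket
satisfying super skew-symmetry and the super Jacobi identity on homogeneous elements. -/
structure LieSuperAlgebra (F : Type) [Field F] (L : Type) [AddCommGroup L] [Module F L] where
  bracket : L →ₗ[F] L →ₗ[F] L
  carrier : ZMod 2 → Submodule F L
  isCompl : IsCompl (carrier 0) (carrier 1)
  bracket_mem : ∀ i j : ZMod 2, ∀ x ∈ carrier i, ∀ y ∈ carrier j, bracket x y ∈ carrier (i + j)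
  skew : ∀ i j : ZMod 2, ∀ x ∈ carrier i, ∀ y ∈ carrier j,
    bracket x y = -(((-1 : F) ^ (i.val * j.val)) • bracket y x)
  super_jacobi : ∀ i j : ZMod 2, ∀ x ∈ carrier i, ∀ y ∈ carrier j, ∀ z : L,
    bracket (bracket x y) z
      = bracket x (bracket y z) - ((-1 : F) ^ (i.val * j.val)) • bracket y (bracket x z)

variable {F : Type} [Field F] {L : Type} [AddCommGroup L] [Module F L]

/-- An `osp`-triple for a Lie superalgebra: nonzero odd elements `e, f` and an even
element `h` generating `g`, with `[h,e] = 2e`, `[h,f] = -2f`, `[e,f] = h`. -/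
structure LieSuperAlgebra.IsOspTriple (g : LieSuperAlgebra F L) (e f h : L) : Prop where
  e_mem : e ∈ g.carrier 1
  f_mem : f ∈ g.carrier 1
  h_mem : h ∈ g.carrier 0
  e_ne : e ≠ 0
  f_ne : f ≠ 0
  h_ne : h ≠ 0
  he : g.bracket h e = (2 : F) • e
  hf : g.bracket h f = -((2 : F) • f)
  ef : g.bracket e f = h
  gen : ∀ S : Submodule F L, e ∈ S → f ∈ S → h ∈ S →
    (∀ x ∈ S, ∀ y ∈ S, g.bracket x y ∈ S) → S = ⊤

/-- A module over a Lie superalgebra. -/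
structure LieSuperModule (g : LieSuperAlgebra F L)
    (V : Type) [AddCommGroup V] [Module F V] where
  act : L →ₗ[F] V →ₗ[F] V
  carrier : ZMod 2 → Submodule F V
  isCompl : IsCompl (carrier 0) (carrier 1)
  act_mem : ∀ i j : ZMod 2, ∀ x ∈ g.carrier i, ∀ v ∈ carrier j, act x v ∈ carrier (i + j)
  bracket_act : ∀ i j : ZMod 2, ∀ x ∈ g.carrier i, ∀ y ∈ g.carrier j, ∀ v : V,
    act (g.bracket x y) v = act x (act y v) - ((-1 : F) ^ (i.val * j.val)) • act y (act x v)

variable {V : Type} [AddCommGroup V] [Module F V]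

/-- A (graded) submodule of a Lie supermodule. -/
def LieSuperModule.IsSub {g : LieSuperAlgebra F L} (M : LieSuperModule g V)
    (W : Submodule F V) : Prop :=
  W ≤ (W ⊓ M.carrier 0) ⊔ (W ⊓ M.carrier 1) ∧ ∀ x : L, ∀ v ∈ W, M.act x v ∈ W

/-- Irreducibility of a Lie supermodule. -/
def LieSuperModule.IsIrreducible {g : LieSuperAlgebra F L} (M : LieSuperModule g V) : Prop :=
  (∃ v : V, v ≠ 0) ∧ ∀ W : Submodule F V, M.IsSub W → W = ⊥ ∨ W = ⊤

/-- Isomorphism of Lie supermodules: a bijective linear map of some parity `p`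
compatible with the actions up to the sign `(-1)^{|x| p}`. -/
def LieSuperModule.Iso {g : LieSuperAlgebra F L} {W : Type} [AddCommGroup W] [Module F W]
    (M : LieSuperModule g V) (N : LieSuperModule g W) : Prop :=
  ∃ (φ : V ≃ₗ[F] W) (p : ZMod 2),
    (∀ j : ZMod 2, Submodule.map (φ : V →ₗ[F] W) (M.carrier j) = N.carrier (j + p)) ∧
    ∀ i : ZMod 2, ∀ x ∈ g.carrier i, ∀ v : V,
      φ (M.act x v) = ((-1 : F) ^ (i.val * p.val)) • N.act x (φ v)

/-- Operators of an `osp(1,2)`-representation on a vector space, without reference to parity. -/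
structure OspOperators (E D H : V →ₗ[F] V) : Prop where
  hE : ∀ v, H (E v) = E (H v) + (2 : F) • E v
  hD : ∀ v, H (D v) = D (H v) - (2 : F) • D v
  eD : ∀ v, H v = E (D v) + D (E v)

namespace OspOperators

variable {E D H : V →ₗ[F] V}

/-- Exchanging the roles of the raising and lowering operators. -/
theorem symm (t : OspOperators E D H) : OspOperators D (-E) (-H) where
  hE v := by simp [t.hD, sub_eq_add_neg, add_comm]
  hD v := by simp [t.hE]
  eD v := by simp [t.eD]

theorem hD_pow (t : OspOperators E D H) (n : ℕ) (v : V) :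
    H ((D ^ n) v) = (D ^ n) (H v) - (2 * n : F) • (D ^ n) v := by
  induction n with
  | zero => simp
  | succ n ih =>
    simp only [pow_succ', Module.End.mul_apply, t.hD, ih, map_sub, map_smul]
    push_cast
    module

/-- The lowering operator is nilpotent, since its powers are eigenvectors of `ad H`. -/
theorem isNilpotent [CharZero F] [FiniteDimensional F V] (t : OspOperators E D H) :
    IsNilpotent D := by
  by_contra hn
  have hne : ∀ n, D ^ n ≠ 0 := fun n h0 => hn ⟨n, h0⟩
  let ad : Module.End F (Module.End F V) := LinearMap.mulLeft F H - LinearMap.mulRight F H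
  have hev : ∀ n : ℕ, ad.HasEigenvalue (-(2 * n : F)) := fun n => by
    refine Module.End.hasEigenvalue_of_hasEigenvector (x := D ^ n)
      ⟨Module.End.mem_eigenspace_iff.2 ?_, hne n⟩
    ext v
    simp [ad, t.hD_pow n v]
  have hinj : Function.Injective (fun n : ℕ => (-(2 * n) : F)) := fun a b hab => by
    simpa using hab
  exact Set.infinite_of_injective_forall_mem hinj hev ad.finite_hasEigenvalue

theorem commute_comp (t : OspOperators E D H) (v : V) : D (E (H v)) = H (D (E v)) := by
  have h1 := t.hE v
  have h2 := t.hD (E v)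
  rw [h1, map_add, map_smul] at h2
  rw [h2]; abel

/-- The string relations below a vector killed by `D E`. -/
theorem string (t : OspOperators E D H) {x : V} (hx : D (E x) = 0) (j : ℕ) :
    E ((D ^ (2 * j + 1)) x) = (D ^ (2 * j)) (H x - (2 * j : F) • x) ∧
      E ((D ^ (2 * j + 2)) x) = -((2 * j + 2 : F) • (D ^ (2 * j + 1)) x) := by
  have step : ∀ n, E ((D ^ (n + 1)) x) = H ((D ^ n) x) - D (E ((D ^ n) x)) := fun n => by
    rw [t.eD, pow_succ', Module.End.mul_apply]; abel
  have odd_to_even : ∀ j : ℕ,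
      E ((D ^ (2 * j + 1)) x) = (D ^ (2 * j)) (H x - (2 * j : F) • x) →
      E ((D ^ (2 * j + 2)) x) = -((2 * j + 2 : F) • (D ^ (2 * j + 1)) x) := fun j h1 => by
    rw [step (2 * j + 1), h1, t.hD_pow, ← Module.End.mul_apply D, ← pow_succ', map_sub, map_smul]
    push_cast
    module
  induction j with
  | zero =>
    have h0 : E ((D ^ (2 * 0 + 1)) x) = (D ^ (2 * 0)) (H x - (2 * (0 : ℕ) : F) • x) := by
      simp [t.eD, hx]
    exact ⟨h0, odd_to_even 0 h0⟩
  | succ j ih =>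
    have h1 : E ((D ^ (2 * (j + 1) + 1)) x)
        = (D ^ (2 * (j + 1))) (H x - (2 * (j + 1 : ℕ) : F) • x) := by
      rw [step (2 * (j + 1)), show 2 * (j + 1) = 2 * j + 2 by ring, ih.2, t.hD_pow, map_neg,
        map_smul, ← Module.End.mul_apply D, ← pow_succ', map_sub, map_smul]
      push_cast
      module
    exact ⟨h1, odd_to_even _ h1⟩

theorem aeval_prod_apply_eq_zero [CharZero F] (t : OspOperators E D H) (m : ℕ) :
    ∀ x, D (E x) = 0 → (D ^ (2 * m)) x = 0 →
      Polynomial.aeval H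
        (∏ j ∈ Finset.range m, (Polynomial.X - Polynomial.C (2 * j : F))) x = 0 := by
  induction m with
  | zero => intro x _ h; simpa using h
  | succ m ih =>
    intro x hx h
    have h1 : (D ^ (2 * m + 1)) x = 0 := by
      have h2 := (t.string hx m).2
      rw [show 2 * m + 2 = 2 * (m + 1) by ring, h, map_zero, eq_comm, neg_eq_zero,
        smul_eq_zero] at h2
      exact h2.resolve_left (by exact_mod_cast Nat.succ_ne_zero (2 * m + 1))
    have h3 := (t.string hx m).1
    rw [h1, map_zero] at h3
    have h4 := ih (H x - (2 * m : F) • x)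
      (by rw [map_sub, map_sub, t.commute_comp, map_smul, map_smul, hx]; simp) h3.symm
    rw [Finset.prod_range_succ, map_mul, Module.End.mul_apply]
    have hfac : Polynomial.aeval H (Polynomial.X - Polynomial.C (2 * m : F)) x
        = H x - (2 * m : F) • x := by
      rw [map_sub, Polynomial.aeval_X, Polynomial.aeval_C, LinearMap.sub_apply,
        Module.algebraMap_end_apply]
    rw [hfac, h4]

/-- The kernel of `D E` has only the weights `0, 2, 4, …`. -/
theorem exists_aeval_prod_apply_eq_zero [CharZero F] [FiniteDimensional F V]
    (t : OspOperators E D H) : ∃ m : ℕ, ∀ x, D (E x) = 0 →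
      Polynomial.aeval H
        (∏ j ∈ Finset.range m, (Polynomial.X - Polynomial.C (2 * j : F))) x = 0 := by
  obtain ⟨n, hn⟩ := t.isNilpotent
  refine ⟨n, fun x hx => t.aeval_prod_apply_eq_zero n x hx ?_⟩
  rw [two_mul, pow_add, hn]; simp

/-- The kernel of `E D` has only the weights `0, -2, -4, …`. -/
theorem exists_aeval_prod_apply_eq_zero' [CharZero F] [FiniteDimensional F V]
    (t : OspOperators E D H) : ∃ m : ℕ, ∀ x, E (D x) = 0 →
      Polynomial.aeval H
        (∏ j ∈ Finset.range m, (Polynomial.X - Polynomial.C (-(2 * j) : F))) x = 0 := by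
  obtain ⟨m, hm⟩ := t.symm.exists_aeval_prod_apply_eq_zero
  refine ⟨m, fun x hx => ?_⟩
  have h1 := hm x (by simp [hx])
  have h2 : Polynomial.aeval (-H)
      (∏ j ∈ Finset.range m, (Polynomial.X - Polynomial.C (2 * j : F)))
      = (-1 : F) ^ m • Polynomial.aeval H
        (∏ j ∈ Finset.range m, (Polynomial.X - Polynomial.C (-(2 * j) : F))) := by
    clear hm h1
    induction m with
    | zero => simp
    | succ m ih =>
      have hfac : Polynomial.aeval (-H) (Polynomial.X - Polynomial.C (2 * m : F))
          = -Polynomial.aeval H (Polynomial.X - Polynomial.C (-(2 * m) : F)) := by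
        simp only [map_sub, map_neg, Polynomial.aeval_X, Polynomial.aeval_C]
        abel
      rw [Finset.prod_range_succ, Finset.prod_range_succ, map_mul (Polynomial.aeval (-H)),
        map_mul (Polynomial.aeval H), ih, hfac, pow_succ, mul_neg,
        smul_mul_assoc, mul_neg_one, neg_smul]
  rw [h2, LinearMap.smul_apply, smul_eq_zero] at h1
  exact h1.resolve_left (by simp)

theorem raise_eq_zero [CharZero F] [FiniteDimensional F V] (t : OspOperators E D H)
    {x : V} (hx : D (E x) = 0) : E x = 0 := by
  obtain ⟨m, hm⟩ := t.exists_aeval_prod_apply_eq_zero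
  obtain ⟨n, hn⟩ := t.exists_aeval_prod_apply_eq_zero'
  have h1 := hn (E x) (by simp [hx])
  have shift : ∀ x, Polynomial.aeval H
      (∏ j ∈ Finset.range m, (Polynomial.X - Polynomial.C (2 * j + 2 : F))) (E x)
      = E (Polynomial.aeval H
        (∏ j ∈ Finset.range m, (Polynomial.X - Polynomial.C (2 * j : F))) x) := by
    clear hm
    induction m with
    | zero => simp
    | succ m ih =>
      intro x
      rw [Finset.prod_range_succ, Finset.prod_range_succ, map_mul, map_mul,
        Module.End.mul_apply, Module.End.mul_apply, ← ih]
      congr 1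
      simp only [map_sub, Polynomial.aeval_X, Polynomial.aeval_C, LinearMap.sub_apply,
        Module.algebraMap_end_apply, t.hE, map_smul]
      module
  have h2 := shift x
  rw [hm x hx, map_zero] at h2
  have hcop : IsCoprime
      (∏ j ∈ Finset.range m, (Polynomial.X - Polynomial.C (2 * j + 2 : F)))
      (∏ j ∈ Finset.range n, (Polynomial.X - Polynomial.C (-(2 * j) : F))) := by
    refine IsCoprime.prod_left fun i _ => IsCoprime.prod_right fun j _ =>
      Polynomial.isCoprime_X_sub_C_of_isUnit_sub (isUnit_iff_ne_zero.2 ?_)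
    rw [sub_neg_eq_add]
    exact_mod_cast (by omega : 2 * i + 2 + 2 * j ≠ 0)
  exact Submodule.disjoint_def.1 (Polynomial.disjoint_ker_aeval_of_isCoprime H hcop) _ h2 h1

theorem lower_eq_zero [CharZero F] [FiniteDimensional F V] (t : OspOperators E D H)
    {x : V} (hx : E (D x) = 0) : D x = 0 :=
  t.symm.raise_eq_zero (by simp [hx])

theorem disjoint_ker_range [CharZero F] [FiniteDimensional F V] (t : OspOperators E D H) :
    Disjoint (LinearMap.ker D) (LinearMap.range E) := by
  rw [Submodule.disjoint_def]
  rintro _ hx ⟨y, rfl⟩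
  exact t.raise_eq_zero hx

theorem ker_sup_range [CharZero F] [FiniteDimensional F V] (t : OspOperators E D H) :
    LinearMap.ker D ⊔ LinearMap.range E = ⊤ := by
  have h2 : Disjoint (LinearMap.ker E) (LinearMap.range D) := by
    rw [Submodule.disjoint_def]
    rintro _ hx ⟨y, rfl⟩
    exact t.lower_eq_zero hx
  have := LinearMap.finrank_range_add_finrank_ker D
  have := LinearMap.finrank_range_add_finrank_ker E
  have := Submodule.finrank_add_finrank_le_of_disjoint h2
  exact Submodule.eq_top_of_disjoint _ _ (by omega) t.disjoint_ker_range

/-- A subspace stable under the raising operator and containing the lowest vectors is everything. -/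
theorem eq_top_of_ker_le [CharZero F] [FiniteDimensional F V] (t : OspOperators E D H)
    {G : Submodule F V} (hker : LinearMap.ker D ≤ G) (hG : ∀ v ∈ G, E v ∈ G) : G = ⊤ := by
  have hpow : ∀ n (v : V), ∃ g ∈ G, ∃ w, v = g + (E ^ n) w := by
    intro n
    induction n with
    | zero => exact fun v => ⟨0, G.zero_mem, v, by simp⟩
    | succ n ih =>
      intro v
      have hv : v ∈ LinearMap.ker D ⊔ LinearMap.range E := by
        rw [t.ker_sup_range]; trivial
      obtain ⟨k, hk, _, ⟨u, rfl⟩, rfl⟩ := Submodule.mem_sup.1 hv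
      obtain ⟨g, hg, w, rfl⟩ := ih u
      refine ⟨k + E g, G.add_mem (hker hk) (hG g hg), w, ?_⟩
      rw [map_add, pow_succ', Module.End.mul_apply, add_assoc]
  obtain ⟨n, hn⟩ := t.symm.isNilpotent
  rw [neg_pow] at hn
  have hn' : E ^ n = 0 := by
    rcases neg_one_pow_eq_or (Module.End F V) n with h | h <;> simpa [h] using hn
  refine Submodule.eq_top_iff'.2 fun v => ?_
  obtain ⟨g, hg, w, rfl⟩ := hpow n v
  simpa [hn'] using hg

/-- The span of the string above `z`. -/
def upString (E : V →ₗ[F] V) (z : V) : Submodule F V :=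
  Submodule.span F (Set.range fun k : ℕ => (E ^ k) z)

theorem mem_upString (E : V →ₗ[F] V) (z : V) : z ∈ upString E z :=
  Submodule.subset_span ⟨0, by simp⟩

theorem raise_mem_upString {z v : V} (hv : v ∈ upString E z) : E v ∈ upString E z := by
  have : upString E z ≤ (upString E z).comap E := by
    refine Submodule.span_le.2 ?_
    rintro _ ⟨k, rfl⟩
    exact Submodule.subset_span ⟨k + 1, by simp [pow_succ']⟩
  exact this hv

theorem upString_le {z : V} {W : Submodule F V} (hz : z ∈ W) (hW : ∀ v ∈ W, E v ∈ W) :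
    upString E z ≤ W := by
  refine Submodule.span_le.2 ?_
  rintro _ ⟨k, rfl⟩
  induction k with
  | zero => simpa using hz
  | succ k ih => simpa [pow_succ'] using hW _ ih

theorem lower_mem_upString (t : OspOperators E D H) {z : V} {c : F} (hz : D z = 0)
    (hc : H z = c • z) {v : V} (hv : v ∈ upString E z) : D v ∈ upString E z := by
  have hH : ∀ k, H ((E ^ k) z) ∈ upString E z := by
    intro k
    induction k with
    | zero => simpa [hc] using Submodule.smul_mem _ c (mem_upString E z)
    | succ k ih =>
      rw [pow_succ', Module.End.mul_apply, t.hE]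
      exact (upString E z).add_mem (raise_mem_upString ih) (Submodule.smul_mem _ _
        (raise_mem_upString (Submodule.subset_span ⟨k, rfl⟩)))
  have : upString E z ≤ (upString E z).comap D := by
    refine Submodule.span_le.2 ?_
    rintro _ ⟨k, rfl⟩
    induction k with
    | zero => simp [hz]
    | succ k ih =>
      have h1 : D ((E ^ (k + 1)) z) = H ((E ^ k) z) - E (D ((E ^ k) z)) := by
        rw [t.eD, pow_succ', Module.End.mul_apply]; abel
      change D ((E ^ (k + 1)) z) ∈ upString E z
      rw [h1]
      exact sub_mem (hH k) (raise_mem_upString ih)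
  exact this hv

/-- Every nonzero subspace of the string stable under `D` contains its lowest vector. -/
theorem mem_of_le_upString [CharZero F] [FiniteDimensional F V] (t : OspOperators E D H)
    {z : V} (hz : D z = 0) {W : Submodule F V}
    (hle : W ≤ upString E z) (hW : ∀ v ∈ W, D v ∈ W) (hne : W ≠ ⊥) : z ∈ W := by
  obtain ⟨w, hw, hw0⟩ := W.exists_mem_ne_zero_of_ne_bot hne
  obtain ⟨y, hy, hy0, hDy⟩ : ∃ y ∈ W, y ≠ 0 ∧ D y = 0 := by
    by_contra! hcon
    have hpow : ∀ n, (D ^ n) w ∈ W ∧ (D ^ n) w ≠ 0 := by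
      intro n
      induction n with
      | zero => exact ⟨by simpa using hw, by simpa using hw0⟩
      | succ n ih =>
        rw [pow_succ', Module.End.mul_apply]
        exact ⟨hW _ ih.1, hcon _ ih.1 ih.2⟩
    obtain ⟨n, hn⟩ := t.isNilpotent
    exact (hpow n).2 (by simp [hn])
  have hdec : upString E z ≤ Submodule.span F {z} ⊔ LinearMap.range E := by
    refine Submodule.span_le.2 ?_
    rintro _ ⟨k, rfl⟩
    cases k with
    | zero => exact Submodule.mem_sup_left (by simp)
    | succ k => exact Submodule.mem_sup_right ⟨(E ^ k) z, by simp [pow_succ']⟩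
  obtain ⟨_, ha, _, ⟨u, rfl⟩, rfl⟩ := Submodule.mem_sup.1 (hdec (hle hy))
  obtain ⟨a, rfl⟩ := Submodule.mem_span_singleton.1 ha
  have hu : E u = 0 := t.raise_eq_zero (by simpa [hz] using hDy)
  rw [hu, add_zero] at hy hy0
  exact (Submodule.smul_mem_iff _ (left_ne_zero_of_smul hy0)).1 hy

/-- An `H`-stable subspace of lowest vectors is spanned by its weight vectors. -/
theorem mem_of_eigenvectors_mem [CharZero F] [FiniteDimensional F V] (t : OspOperators E D H)
    {T G : Submodule F V} (hT : ∀ v ∈ T, H v ∈ T) (hTD : T ≤ LinearMap.ker D)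
    (hG : ∀ v ∈ T, ∀ c : F, H v = c • v → v ∈ G) : T ≤ G := by
  obtain ⟨m, hm⟩ := t.exists_aeval_prod_apply_eq_zero'
  have key : ∀ n : ℕ, ∀ x ∈ T, Polynomial.aeval H
      (∏ j ∈ Finset.range n, (Polynomial.X - Polynomial.C (-(2 * j) : F))) x = 0 → x ∈ G := by
    intro n
    induction n with
    | zero => intro x _ h; simp at h; simp [h]
    | succ n ih =>
      intro x hx h
      set p := ∏ j ∈ Finset.range n, (Polynomial.X - Polynomial.C (-(2 * j) : F)) with hp
      have hpx : Polynomial.aeval H p x ∈ T :=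
        Polynomial.aeval_apply_smul_mem_of_le_comap hx p H hT
      have hev : H (Polynomial.aeval H p x) = (-(2 * n) : F) • Polynomial.aeval H p x := by
        rw [Finset.prod_range_succ, ← hp, mul_comm, map_mul, Module.End.mul_apply] at h
        rw [← sub_eq_zero]
        rw [map_sub, Polynomial.aeval_X, Polynomial.aeval_C, LinearMap.sub_apply,
          Module.algebraMap_end_apply] at h
        exact h
      have hpe : p.eval (-(2 * n) : F) ≠ 0 := by
        rw [hp, Polynomial.eval_prod, Finset.prod_ne_zero_iff]
        intro j hj
        simpa [neg_add_eq_zero] using (Finset.mem_range.1 hj).ne'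
      have hpp : Polynomial.aeval H p (Polynomial.aeval H p x)
          = p.eval (-(2 * n) : F) • Polynomial.aeval H p x := by
        rcases eq_or_ne (Polynomial.aeval H p x) 0 with h0 | h0
        · rw [h0, map_zero, smul_zero]
        · exact Module.End.aeval_apply_of_hasEigenvector
            ⟨Module.End.mem_eigenspace_iff.2 hev, h0⟩
      have h1 := ih (x - (p.eval (-(2 * n) : F))⁻¹ • Polynomial.aeval H p x)
        (sub_mem hx (T.smul_mem _ hpx))
        (by rw [map_sub, map_smul, hpp, smul_smul, inv_mul_cancel₀ hpe, one_smul, sub_self])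
      have h2 := G.add_mem h1 (G.smul_mem (p.eval (-(2 * n) : F))⁻¹ (hG _ hpx _ hev))
      simpa using h2
  intro x hx
  exact key m x hx (hm x (by rw [LinearMap.mem_ker.1 (hTD hx), map_zero]))

end OspOperators

namespace LieSuperModule

variable {g : LieSuperAlgebra F L}

theorem ospOperators {e f h : L} (ht : g.IsOspTriple e f h) (M : LieSuperModule g V) :
    OspOperators (M.act e) (M.act f) (M.act h) where
  hE v := by
    have := M.bracket_act 0 1 h ht.h_mem e ht.e_mem v
    rw [ht.he] at this
    simp at this
    rw [this]; abel
  hD v := by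
    have := M.bracket_act 0 1 h ht.h_mem f ht.f_mem v
    rw [ht.hf] at this
    simp at this
    rw [sub_eq_add_neg, this]; abel
  eD v := by
    have := M.bracket_act 1 1 e ht.e_mem f ht.f_mem v
    rw [ht.ef] at this
    simpa [ZMod.val_one] using this

/-- A subspace stable under the odd generators is stable under the whole superalgebra. -/
theorem act_mem_of_generators {e f h : L} (ht : g.IsOspTriple e f h) (M : LieSuperModule g V)
    {W : Submodule F V} (he : ∀ v ∈ W, M.act e v ∈ W) (hf : ∀ v ∈ W, M.act f v ∈ W)
    (x : L) : ∀ v ∈ W, M.act x v ∈ W := by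
  let T : Submodule F L :=
    { carrier := {x | ∀ v ∈ W, M.act x v ∈ W}
      add_mem' := fun ha hb v hv => by
        rw [map_add, LinearMap.add_apply]; exact W.add_mem (ha v hv) (hb v hv)
      zero_mem' := fun v _ => by simp
      smul_mem' := fun c a ha v hv => by
        rw [map_smul, LinearMap.smul_apply]; exact W.smul_mem c (ha v hv) }
  have hh : h ∈ T := fun v hv => by
    rw [(M.ospOperators ht).eD]
    exact W.add_mem (he _ (hf v hv)) (hf _ (he v hv))
  let S : Submodule F L := (T ⊓ g.carrier 0) ⊔ (T ⊓ g.carrier 1)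
  have hS : ∀ i : ZMod 2, T ⊓ g.carrier i ≤ S := by
    intro i
    fin_cases i
    · exact le_sup_left
    · exact le_sup_right
  have hbr : ∀ i j : ZMod 2, ∀ a ∈ T ⊓ g.carrier i, ∀ b ∈ T ⊓ g.carrier j,
      g.bracket a b ∈ S := by
    rintro i j a ⟨ha, hai⟩ b ⟨hb, hbj⟩
    refine hS (i + j) ⟨fun v hv => ?_, g.bracket_mem i j a hai b hbj⟩
    rw [M.bracket_act i j a hai b hbj]
    exact W.sub_mem (ha _ (hb v hv)) (W.smul_mem _ (hb _ (ha v hv)))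
  have htop : S = ⊤ := by
    refine ht.gen S (hS 1 ⟨he, ht.e_mem⟩) (hS 1 ⟨hf, ht.f_mem⟩) (hS 0 ⟨hh, ht.h_mem⟩) ?_
    intro a ha b hb
    obtain ⟨a0, ha0, a1, ha1, rfl⟩ := Submodule.mem_sup.1 ha
    obtain ⟨b0, hb0, b1, hb1, rfl⟩ := Submodule.mem_sup.1 hb
    simp only [map_add, LinearMap.add_apply]
    exact add_mem (add_mem (hbr 0 0 _ ha0 _ hb0) (hbr 1 0 _ ha1 _ hb0))
      (add_mem (hbr 0 1 _ ha0 _ hb1) (hbr 1 1 _ ha1 _ hb1))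
  have hST : S ≤ T := sup_le inf_le_left inf_le_left
  exact hST (htop ▸ Submodule.mem_top)

/-- The string above a homogeneous lowest weight vector is a graded submodule. -/
theorem isSub_upString {e f h : L} (ht : g.IsOspTriple e f h) (M : LieSuperModule g V)
    {i : ZMod 2} {z : V} (hi : z ∈ M.carrier i) {c : F} (hz : M.act f z = 0)
    (hc : M.act h z = c • z) : M.IsSub (OspOperators.upString (M.act e) z) := by
  refine ⟨Submodule.span_le.2 ?_, M.act_mem_of_generators ht
    (fun v => OspOperators.raise_mem_upString)
    fun v => (M.ospOperators ht).lower_mem_upString hz hc⟩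
  rintro _ ⟨k, rfl⟩
  have hmem : ∀ k : ℕ, ∃ j, (M.act e ^ k) z ∈ M.carrier j := by
    intro k
    induction k with
    | zero => exact ⟨i, by simpa using hi⟩
    | succ k ih =>
      obtain ⟨j, hj⟩ := ih
      exact ⟨1 + j, by simpa [pow_succ'] using M.act_mem 1 j e ht.e_mem _ hj⟩
  have hk : (M.act e ^ k) z ∈ OspOperators.upString (M.act e) z :=
    Submodule.subset_span ⟨k, rfl⟩
  obtain ⟨j, hj⟩ := hmem k
  fin_cases j
  · exact Submodule.mem_sup_left ⟨hk, hj⟩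
  · exact Submodule.mem_sup_right ⟨hk, hj⟩

/-- The kernel of an odd element is graded. -/
theorem ker_act_le (M : LieSuperModule g V) {f : L} (hf : f ∈ g.carrier 1) :
    LinearMap.ker (M.act f) ≤ (LinearMap.ker (M.act f) ⊓ M.carrier 0) ⊔
      (LinearMap.ker (M.act f) ⊓ M.carrier 1) := by
  intro x hx
  have hx' : x ∈ M.carrier 0 ⊔ M.carrier 1 := by rw [M.isCompl.sup_eq_top]; trivial
  obtain ⟨a, ha, b, hb, rfl⟩ := Submodule.mem_sup.1 hx'
  have h1 : M.act f a ∈ M.carrier 1 := M.act_mem 1 0 f hf a ha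
  have h0 : M.act f b ∈ M.carrier 0 := M.act_mem 1 1 f hf b hb
  rw [LinearMap.mem_ker, map_add] at hx
  have hfb : M.act f b = 0 := by
    refine Submodule.disjoint_def.1 M.isCompl.disjoint _ h0 ?_
    rw [eq_neg_of_add_eq_zero_right hx]
    exact neg_mem h1
  have hfa : M.act f a = 0 := by rwa [hfb, add_zero] at hx
  exact Submodule.add_mem_sup ⟨hfa, ha⟩ ⟨hfb, hb⟩

end LieSuperModule

/-- every finite-dimensional module of `osp(1,2)` is completely reducible,
i.e. it is the sum of its irreducible submodules. -/
theorem osp_complete_reducibility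
    {F : Type} [Field F] [CharZero F] {L : Type} [AddCommGroup L] [Module F L]
    (g : LieSuperAlgebra F L) (e f h : L) (ht : g.IsOspTriple e f h)
    {V : Type} [AddCommGroup V] [Module F V] [FiniteDimensional F V]
    (M : LieSuperModule g V) :
    sSup {W : Submodule F V | M.IsSub W ∧ W ≠ ⊥ ∧
        ∀ W' : Submodule F V, W' ≤ W → M.IsSub W' → W' = ⊥ ∨ W' = W} = ⊤ := by
  have t := M.ospOperators ht
  set P : Set (Submodule F V) := {W | M.IsSub W ∧ W ≠ ⊥ ∧
    ∀ W' : Submodule F V, W' ≤ W → M.IsSub W' → W' = ⊥ ∨ W' = W}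
  have hstring : ∀ i : ZMod 2, ∀ z ∈ M.carrier i, ∀ c : F, M.act f z = 0 →
      M.act h z = c • z → z ∈ sSup P := by
    intro i z hi c hz hc
    rcases eq_or_ne z 0 with rfl | hz0
    · exact zero_mem _
    have hmem : OspOperators.upString (M.act e) z ∈ P := by
      refine ⟨M.isSub_upString ht hi hz hc, ?_, ?_⟩
      · exact (Submodule.ne_bot_iff _).2 ⟨z, OspOperators.mem_upString _ z, hz0⟩
      · intro W' hle hW'
        refine or_iff_not_imp_left.2 fun hne => le_antisymm hle ?_
        exact OspOperators.upString_le (t.mem_of_le_upString hz hle (hW'.2 f) hne) (hW'.2 e)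
    exact le_sSup hmem (OspOperators.mem_upString _ z)
  have hker : ∀ i : ZMod 2, LinearMap.ker (M.act f) ⊓ M.carrier i ≤ sSup P := by
    intro i
    refine t.mem_of_eigenvectors_mem ?_ inf_le_left
      fun v hv c hc => hstring i v hv.2 c hv.1 hc
    rintro v ⟨hv, hvi⟩
    refine ⟨?_, by simpa using M.act_mem 0 i h ht.h_mem v hvi⟩
    have h1 := t.hD v
    rw [LinearMap.mem_ker.1 hv] at h1
    simpa using h1.symm
  refine t.eq_top_of_ker_le ((M.ker_act_le ht.f_mem).trans (sup_le (hker 0) (hker 1))) ?_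
  have hE : sSup P ≤ (sSup P).comap (M.act e) :=
    sSup_le fun W hW v hv => le_sSup hW (hW.1.2 e v hv)
  exact fun v hv => hE hv
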